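/- Let f: E → ℂ be given on the tube E = iV* + E_ℝ (E_ℝ ⊆ V* convex, nonempty interior) as the Laplace transform f(λ) = ∫ e^{λ(X)} dμ(X) of a positive measure μ on a finite-dimensional real vector space V. Then f admits no holomorphic extension to any connected open tube domain strictly containing int E: the domain of convergence is maximal among tube domains of holomorphy. -/

import Mathlib

open MeasureTheory

open ProbabilityTheory in
lemma landau_one {Ω : Type*} [MeasurableSpace Ω] (ν : Measure Ω) (X : Ω → ℝ) (hX : Measurable X)
    (h0 : (0 : ℝ) ∈ interior (integrableExpSet X ν)) (h : ℂ → ℂ) (ρ : ℝ) (hρ : 1 < ρ)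
    (hd : DifferentiableOn ℂ h (Metric.ball 0 ρ))
    (heq : h =ᶠ[nhds 0] complexMGF X ν) :
    Integrable (fun ω => Real.exp (X ω)) ν := by
  have hs := (Complex.hasSum_taylorSeries_on_ball hd (z := 1) (by simpa using hρ)).summable
  have hs2 := (hs.comp_injective (i := fun n : ℕ => 2 * n)
    (fun a b hab => by simpa using hab)).norm
  have hterm : ∀ n : ℕ, ‖((2 * n).factorial : ℂ)⁻¹ • ((1 : ℂ) - 0) ^ (2 * n) •
      iteratedDeriv (2 * n) h 0‖ = ∫ ω, X ω ^ (2 * n) / (2 * n).factorial ∂ν := by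
    intro n
    rw [heq.iteratedDeriv_eq, iteratedDeriv_complexMGF (by simpa using h0)]
    have e : (∫ ω, (X ω : ℂ) ^ (2 * n) * Complex.exp (0 * X ω) ∂ν)
        = ((∫ ω, X ω ^ (2 * n) ∂ν : ℝ) : ℂ) := by
      rw [← integral_complex_ofReal]
      simp
    rw [e, integral_div]
    have hn : 0 ≤ ∫ ω, X ω ^ (2 * n) ∂ν := integral_nonneg fun ω => (even_two_mul n).pow_nonneg _
    simp only [sub_zero, one_pow, one_smul, norm_smul, norm_inv, Complex.norm_natCast,
      Complex.norm_real, Real.norm_eq_abs, abs_of_nonneg hn]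
    rw [div_eq_inv_mul]
  have hs3 : Summable fun n : ℕ => ∫ ω, X ω ^ (2 * n) / (2 * n).factorial ∂ν := by
    refine hs2.congr fun n => ?_
    exact hterm n
  have hint : ∀ n : ℕ, Integrable (fun ω => X ω ^ (2 * n) / (2 * n).factorial) ν := fun n =>
    (integrable_pow_of_mem_interior_integrableExpSet h0 (2 * n)).div_const _
  have hnn : ∀ (n : ℕ) ω, 0 ≤ X ω ^ (2 * n) / ((2 * n).factorial : ℝ) := fun n ω =>
    div_nonneg ((even_two_mul n).pow_nonneg _) (by positivity)
  have hfin : ∫⁻ ω, ENNReal.ofReal (Real.cosh (X ω)) ∂ν ≠ ⊤ := by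
    have e : ∀ ω, ENNReal.ofReal (Real.cosh (X ω)) =
        ∑' n : ℕ, ENNReal.ofReal (X ω ^ (2 * n) / (2 * n).factorial) := by
      intro ω
      rw [Real.cosh_eq_tsum, ENNReal.ofReal_tsum_of_nonneg (fun n => hnn n ω)
        (Real.hasSum_cosh _).summable]
    simp_rw [e]
    rw [lintegral_tsum (fun n => by fun_prop)]
    have e2 : ∀ n : ℕ, ∫⁻ ω, ENNReal.ofReal (X ω ^ (2 * n) / (2 * n).factorial) ∂ν
        = ENNReal.ofReal (∫ ω, X ω ^ (2 * n) / (2 * n).factorial ∂ν) := fun n =>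
      (ofReal_integral_eq_lintegral_ofReal (hint n) (Filter.Eventually.of_forall (hnn n))).symm
    simp_rw [e2]
    rw [← ENNReal.ofReal_tsum_of_nonneg (fun n => integral_nonneg (hnn n)) hs3]
    exact ENNReal.ofReal_ne_top
  have hcosh : Integrable (fun ω => Real.cosh (X ω)) ν :=
    (lintegral_ofReal_ne_top_iff_integrable (by fun_prop)
      (Filter.Eventually.of_forall fun ω => (Real.cosh_pos _).le)).1 hfin
  refine (hcosh.const_mul 2).mono' (by fun_prop) (Filter.Eventually.of_forall fun ω => ?_)
  rw [Real.norm_eq_abs, Real.abs_exp, Real.cosh_eq]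
  have := Real.exp_pos (-(X ω))
  linarith

open ProbabilityTheory in
lemma landau_ball {V : Type*} [NormedAddCommGroup V] [NormedSpace ℝ V]
    [MeasurableSpace V] [BorelSpace V]
    (μ : Measure V) (a η : V →L[ℝ] ℝ)
    (ha : a ∈ interior {b : V →L[ℝ] ℝ | Integrable (fun X => Real.exp (b X)) μ})
    (h : ℂ → ℂ) (ρ : ℝ) (hρ : 1 < ρ)
    (hd : DifferentiableOn ℂ h (Metric.ball 0 ρ))
    (heq : ∀ᶠ z in nhds (0 : ℂ), h z = ∫ X, Complex.exp (a X + z * η X) ∂μ) :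
    Integrable (fun X => Real.exp ((a + η) X)) μ := by
  have hm : Measurable fun X => Real.toNNReal (Real.exp (a X)) := by fun_prop
  set ν : Measure V := μ.withDensity fun X => (Real.toNNReal (Real.exp (a X)) : ENNReal) with hν
  have key : ∀ t : ℝ, Integrable (fun X => Real.exp (t * η X)) ν ↔
      Integrable (fun X => Real.exp ((a + t • η) X)) μ := by
    intro t
    rw [hν, integrable_withDensity_iff_integrable_coe_smul hm]
    refine integrable_congr (Filter.Eventually.of_forall fun X => ?_)
    simp [Real.coe_toNNReal _ (Real.exp_pos _).le, Real.exp_add]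
  have h0 : (0 : ℝ) ∈ interior (integrableExpSet η ν) := by
    rw [mem_interior_iff_mem_nhds] at ha ⊢
    have hc : Continuous fun t : ℝ => a + t • η := by fun_prop
    have := hc.continuousAt.preimage_mem_nhds (x := 0) (by simpa using ha)
    filter_upwards [this] with t ht
    exact (key t).2 ht
  have := landau_one ν η (by fun_prop) h0 h ρ hρ hd (by
    filter_upwards [heq] with z hz
    rw [hz, complexMGF, hν, integral_withDensity_eq_integral_smul hm]
    congr 1
    ext X
    rw [NNReal.smul_def, Real.coe_toNNReal _ (Real.exp_pos _).le, Complex.exp_add]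
    simp)
  simpa using (key 1).1 (by simpa using this)

/-- The Laplace transform of a positive measure admits no holomorphic extension to a
connected open tube domain strictly larger than the interior of its tube of convergence. -/
theorem stmt_19 {V : Type*} [NormedAddCommGroup V] [NormedSpace ℝ V]
    [FiniteDimensional ℝ V] [MeasurableSpace V] [BorelSpace V]
    (μ : Measure V) [μ.Regular]
    (E : Set (V →L[ℝ] ℂ))
    (hE : E = {φ : V →L[ℝ] ℂ | Integrable (fun X => Complex.exp (φ X)) μ})
    (hEne : (interior E).Nonempty)
    -- a connected open tube domain `T' = iV* + U'` strictly containing `int E`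
    (U' : Set (V →L[ℝ] ℝ)) (hU'open : IsOpen U') (hU'conn : IsConnected U')
    (T' : Set (V →L[ℝ] ℂ))
    (hT' : T' = {φ : V →L[ℝ] ℂ | Complex.reCLM.comp φ ∈ U'})
    (hlarger : interior E ⊆ T') (hstrict : ¬ T' ⊆ interior E) :
    ¬ ∃ g : (V →L[ℝ] ℂ) → ℂ,
        DifferentiableOn ℂ g T' ∧
        Set.EqOn g (fun φ : V →L[ℝ] ℂ => ∫ X, Complex.exp (φ X) ∂μ)
          (interior E) := by
  rintro ⟨g, hg, hgE⟩
  set R : Set (V →L[ℝ] ℝ) := {b : V →L[ℝ] ℝ | Integrable (fun X => Real.exp (b X)) μ} with hR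
  have hER : ∀ φ : V →L[ℝ] ℂ, φ ∈ E ↔ Complex.reCLM.comp φ ∈ R := by
    intro φ
    rw [hE, hR, Set.mem_ofPred_eq, Set.mem_ofPred_eq,
      ← integrable_norm_iff (by fun_prop)]
    simp [Complex.norm_exp]
  have hcre : Continuous fun φ : V →L[ℝ] ℂ => Complex.reCLM.comp φ :=
    (ContinuousLinearMap.compL ℝ V ℂ ℝ Complex.reCLM).continuous
  have hcof : Continuous fun a : V →L[ℝ] ℝ => Complex.ofRealCLM.comp a :=
    (ContinuousLinearMap.compL ℝ V ℝ ℂ Complex.ofRealCLM).continuous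
  have hint : ∀ φ : V →L[ℝ] ℂ, φ ∈ interior E ↔ Complex.reCLM.comp φ ∈ interior R := by
    intro φ
    constructor
    · intro hφ
      rw [mem_interior_iff_mem_nhds] at hφ ⊢
      have hc : Continuous fun a : V →L[ℝ] ℝ => Complex.ofRealCLM.comp a +
        (φ - Complex.ofRealCLM.comp (Complex.reCLM.comp φ)) := by fun_prop
      have := hc.continuousAt.preimage_mem_nhds (x := Complex.reCLM.comp φ) (by simpa using hφ)
      filter_upwards [this] with a ha
      have := (hER _).1 ha
      convert this using 1
      ext X
      simp
    · intro hφ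
      have : (fun φ : V →L[ℝ] ℂ => Complex.reCLM.comp φ) ⁻¹' interior R ⊆ interior E :=
        interior_maximal (fun ψ hψ => (hER ψ).2 (interior_subset hψ))
          (isOpen_interior.preimage hcre)
      exact this hφ
  have hre : ∀ a : V →L[ℝ] ℝ, Complex.reCLM.comp (Complex.ofRealCLM.comp a) = a := by
    intro a; ext X; simp
  have hRU : interior R ⊆ U' := by
    intro a ha
    have := hlarger ((hint (Complex.ofRealCLM.comp a)).2 (by rwa [hre]))
    rw [hT', Set.mem_ofPred_eq, hre] at this
    exact this
  have hnR : ¬ U' ⊆ interior R := by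
    intro hsub
    apply hstrict
    intro φ hφ
    rw [hT'] at hφ
    exact (hint φ).2 (hsub hφ)
  obtain ⟨φ₀, hφ₀⟩ := hEne
  have hRne : (U' ∩ interior R).Nonempty := ⟨_, hRU ((hint φ₀).1 hφ₀), (hint φ₀).1 hφ₀⟩
  apply hnR
  apply hU'conn.isPreconnected.subset_of_closure_inter_subset isOpen_interior hRne
  rintro p ⟨hpc, hpU⟩
  obtain ⟨r, hr, hball⟩ := Metric.isOpen_iff.1 hU'open p hpU
  obtain ⟨a, haR, hpa⟩ := Metric.mem_closure_iff.1 hpc (r / 2) (by positivity)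
  have hball' : Metric.ball a (r / 2) ⊆ U' := fun c hc => hball (by
    rw [Metric.mem_ball] at hc ⊢
    have := dist_triangle c a p
    rw [dist_comm a p] at this
    linarith)
  have hTopen : IsOpen T' := by rw [hT']; exact hU'open.preimage hcre
  suffices hsub : Metric.ball a (r / 2) ⊆ R from
    interior_maximal hsub Metric.isOpen_ball (by simpa [Metric.mem_ball] using hpa)
  intro c hc
  set η := c - a with hη
  have hηr : ‖η‖ < r / 2 := by simpa [dist_eq_norm] using hc
  obtain ⟨ρ, hρ1, hρ⟩ : ∃ ρ : ℝ, 1 < ρ ∧ ρ * ‖η‖ < r / 2 := by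
    have hc : Continuous fun ρ : ℝ => ρ * ‖η‖ := by fun_prop
    have h1 : ∀ᶠ ρ in nhdsWithin (1 : ℝ) (Set.Ioi 1), ρ * ‖η‖ < r / 2 :=
      (hc.continuousAt.eventually_lt continuousAt_const (by simpa using hηr)).filter_mono
        nhdsWithin_le_nhds
    obtain ⟨ρ, h2, h3⟩ := (h1.and self_mem_nhdsWithin).exists
    exact ⟨ρ, h3, h2⟩
  let L : ℂ → (V →L[ℝ] ℂ) := fun z => Complex.ofRealCLM.comp a + z • Complex.ofRealCLM.comp η
  have hL : Differentiable ℂ L := by fun_prop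
  have hLre : ∀ z, Complex.reCLM.comp (L z) = a + z.re • η := by
    intro z; ext X; simp [L]
  have hmaps : Set.MapsTo L (Metric.ball 0 ρ) T' := by
    intro z hz
    rw [hT', Set.mem_ofPred_eq, hLre]
    apply hball'
    rw [mem_ball_zero_iff] at hz
    rw [mem_ball_iff_norm, add_sub_cancel_left, norm_smul]
    refine lt_of_le_of_lt ?_ hρ
    gcongr
    exact (Complex.abs_re_le_norm z).trans hz.le
  have hfin := landau_ball μ a η haR (g ∘ L) ρ hρ1 (hg.comp hL.differentiableOn hmaps) (by
    have h0 : L 0 ∈ interior E := by rw [hint, hLre]; simpa using haR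
    filter_upwards [hL.continuous.continuousAt.preimage_mem_nhds
      (isOpen_interior.mem_nhds h0)] with z hz
    have := hgE hz
    simpa [L] using this)
  have e : a + η = c := by simp [hη]
  rw [e] at hfin
  exact hfin
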